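/- Let G be a group, E a complex Hilbert space, g ≥ 2 an integer, and w ∈ Z₂^{*g}. Let s denote the immediate successor of w in the shortlex order on Z₂^{*g}. If χ : Her W_{≤w} → (G → B(E)) is a positive semidefinite w-partially defined form, then there exists a function χ̄ : Her W_{≤s} → (G → B(E)) whose restriction to Her W_{≤w} equals χ and which is a positive semidefinite s-partially defined form, i.e., for every family (f_v)_{v ∈ W_{≤s}} of finitely supported functions G → E, the sum Σ_{u,v ∈ W_{≤s}} Σ_{g₁,h₁ ∈ G} ⟨ χ̄(u⁻¹v)(g₁⁻¹h₁) f_v(h₁), f_u(g₁) ⟩ is real and nonnegative. -/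

import Mathlib

open scoped ComplexInnerProductSpace

/-- The strict shortlex order on words over the alphabet `Fin n`. -/
def ShortlexLT {n : ℕ} (a b : List (Fin n)) : Prop :=
  a.length < b.length ∨ (a.length = b.length ∧ List.Lex (· < ·) a b)

/-- The shortlex order on words over the alphabet `Fin n`. -/
def ShortlexLE {n : ℕ} (a b : List (Fin n)) : Prop :=
  ShortlexLT a b ∨ a = b

/-- The relations `x_i² = e` presenting the free product of `g` copies of `ℤ/2`. -/
def z2Rels (g : ℕ) : Set (FreeGroup (Fin g)) :=
  {r | ∃ i : Fin g, r = FreeGroup.of i * FreeGroup.of i}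

/-- The free product `ℤ₂^{*g}` of `g` copies of the cyclic group of order two. -/
abbrev Z2Star (g : ℕ) := PresentedGroup (z2Rels g)

/-- The canonical generators of `ℤ₂^{*g}`. -/
def z2of {g : ℕ} (i : Fin g) : Z2Star g := PresentedGroup.of (rels := z2Rels g) i

/-- The element of `ℤ₂^{*g}` given by a word in the generators. -/
def wordZ {g : ℕ} (l : List (Fin g)) : Z2Star g := (l.map z2of).prod

/-- The strict shortlex order on `ℤ₂^{*g}`, via reduced words (words with
consecutive letters distinct), compared in shortlex. -/
def Z2ShortlexLT {g : ℕ} (a b : Z2Star g) : Prop :=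
  ∃ la lb : List (Fin g), List.Chain' (· ≠ ·) la ∧ List.Chain' (· ≠ ·) lb ∧
    wordZ la = a ∧ wordZ lb = b ∧ ShortlexLT la lb

/-- The shortlex order on `ℤ₂^{*g}`, via reduced words. -/
def Z2ShortlexLE {g : ℕ} (a b : Z2Star g) : Prop :=
  ∃ la lb : List (Fin g), List.Chain' (· ≠ ·) la ∧ List.Chain' (· ≠ ·) lb ∧
    wordZ la = a ∧ wordZ lb = b ∧ ShortlexLE la lb

/-- `W_{≤ w}` in `ℤ₂^{*g}`. -/
def WleZ {g : ℕ} (w : Z2Star g) : Set (Z2Star g) := {v | Z2ShortlexLE v w}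

/-- `Her W_{≤ w} = {u⁻¹ v : u, v ∈ W_{≤ w}}` in `ℤ₂^{*g}`. -/
def HerWleZ {g : ℕ} (w : Z2Star g) : Set (Z2Star g) :=
  {α | ∃ u ∈ WleZ w, ∃ v ∈ WleZ w, u⁻¹ * v = α}

/-- A partially defined form `χ`, with values functions `G → B(E)`, is positive
semidefinite relative to the index set `Wset`. -/
def FormPSD {g : ℕ} {G : Type*} [Group G] {E : Type*}
    [NormedAddCommGroup E] [InnerProductSpace ℂ E]
    (Wset : Set (Z2Star g))
    (χ : Z2Star g → G → (E →L[ℂ] E)) : Prop :=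
  ∀ f : Z2Star g → G →₀ E,
    0 ≤ (∑ᶠ u ∈ Wset, ∑ᶠ v ∈ Wset, ∑ᶠ g₁ : G, ∑ᶠ h₁ : G,
          ⟪f u g₁, χ (u⁻¹ * v) (g₁⁻¹ * h₁) (f v h₁)⟫).re ∧
    (∑ᶠ u ∈ Wset, ∑ᶠ v ∈ Wset, ∑ᶠ g₁ : G, ∑ᶠ h₁ : G,
          ⟪f u g₁, χ (u⁻¹ * v) (g₁⁻¹ * h₁) (f v h₁)⟫).im = 0

/-- Left multiplication by the letter `i` on words, cancelling a leading `i`. -/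
def consReduce {n : ℕ} (i : Fin n) : List (Fin n) → List (Fin n)
  | [] => [i]
  | j :: t => if i = j then t else i :: j :: t

/-- The reduced form of a word in the generators of `ℤ₂^{*n}`. -/
def reduceWord {n : ℕ} (l : List (Fin n)) : List (Fin n) := l.foldr consReduce []

section Words

variable {n : ℕ}

theorem consReduce_cons (i j : Fin n) (t : List (Fin n)) :
    consReduce i (j :: t) = if i = j then t else i :: j :: t := rfl

theorem isChain_consReduce (i : Fin n) {l : List (Fin n)} (hl : l.IsChain (· ≠ ·)) :
    (consReduce i l).IsChain (· ≠ ·) := by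
  cases l with
  | nil => simp [consReduce]
  | cons j t =>
    rw [consReduce_cons]
    split_ifs with h
    · exact hl.tail
    · exact List.isChain_cons_cons.2 ⟨h, hl⟩

theorem consReduce_of_isChain {i : Fin n} {l : List (Fin n)} (hl : (i :: l).IsChain (· ≠ ·)) :
    consReduce i l = i :: l := by
  cases l with
  | nil => rfl
  | cons j t => simp [consReduce, (List.isChain_cons_cons.1 hl).1]

theorem consReduce_consReduce (i : Fin n) {l : List (Fin n)} (hl : l.IsChain (· ≠ ·)) :
    consReduce i (consReduce i l) = l := by
  cases l with
  | nil => simp [consReduce]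
  | cons j t =>
    by_cases h : i = j
    · subst h
      simpa [consReduce] using consReduce_of_isChain hl
    · simp [consReduce, h]

theorem isChain_reduceWord (l : List (Fin n)) : (reduceWord l).IsChain (· ≠ ·) := by
  induction l with
  | nil => simp [reduceWord]
  | cons i l ih => exact isChain_consReduce i ih

theorem reduceWord_of_isChain {l : List (Fin n)} (hl : l.IsChain (· ≠ ·)) :
    reduceWord l = l := by
  induction l with
  | nil => rfl
  | cons i l ih =>
    change consReduce i (reduceWord l) = _
    rw [ih hl.tail, consReduce_of_isChain hl]

theorem reduceWord_eq_or_length (l : List (Fin n)) :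
    reduceWord l = l ∨ (reduceWord l).length + 2 ≤ l.length := by
  induction l with
  | nil => exact Or.inl rfl
  | cons i l ih =>
    change consReduce i (reduceWord l) = _ ∨ (consReduce i (reduceWord l)).length + 2 ≤ _
    cases h : reduceWord l with
    | nil =>
      rw [h] at ih
      rcases ih with ih | ih
      · simp [consReduce, ← ih]
      · right; simp [consReduce] at ih ⊢; omega
    | cons j t =>
      rw [h] at ih
      rw [consReduce_cons]
      split_ifs with hij
      · right
        rcases ih with ih | ih
        · simp [← ih]
        · simp at ih ⊢; omega
      · rcases ih with ih | ih
        · simp [ih]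
        · right; simp at ih ⊢; omega

theorem z2of_mul_self (i : Fin n) : z2of i * z2of i = 1 :=
  PresentedGroup.one_of_mem (rels := z2Rels n) ⟨i, rfl⟩

theorem z2of_inv (i : Fin n) : (z2of i)⁻¹ = z2of i :=
  inv_eq_of_mul_eq_one_left (z2of_mul_self i)

theorem wordZ_cons (i : Fin n) (l : List (Fin n)) : wordZ (i :: l) = z2of i * wordZ l := by
  simp [wordZ]

theorem wordZ_append (l m : List (Fin n)) : wordZ (l ++ m) = wordZ l * wordZ m := by
  simp [wordZ]

theorem wordZ_inv (l : List (Fin n)) : (wordZ l)⁻¹ = wordZ l.reverse := by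
  induction l with
  | nil => simp [wordZ]
  | cons i l ih =>
    rw [wordZ_cons, mul_inv_rev, ih, List.reverse_cons, wordZ_append, z2of_inv]
    simp [wordZ]

theorem wordZ_consReduce (i : Fin n) (l : List (Fin n)) :
    wordZ (consReduce i l) = z2of i * wordZ l := by
  cases l with
  | nil => simp [consReduce, wordZ]
  | cons j t =>
    rw [consReduce_cons]
    split_ifs with h
    · rw [h, wordZ_cons, ← mul_assoc, z2of_mul_self, one_mul]
    · rw [wordZ_cons]

theorem wordZ_reduceWord (l : List (Fin n)) : wordZ (reduceWord l) = wordZ l := by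
  induction l with
  | nil => rfl
  | cons i l ih =>
    change wordZ (consReduce i (reduceWord l)) = _
    rw [wordZ_consReduce, ih, wordZ_cons]

/-- A generator of `ℤ₂^{*n}` acting on reduced words. -/
def consReducePerm (i : Fin n) : Equiv.Perm {l : List (Fin n) // l.IsChain (· ≠ ·)} :=
  Function.Involutive.toPerm (fun l => ⟨consReduce i l.1, isChain_consReduce i l.2⟩)
    fun l => Subtype.ext (consReduce_consReduce i l.2)

/-- The action of `ℤ₂^{*n}` on reduced words. -/
def reducedWordAction : Z2Star n →* Equiv.Perm {l : List (Fin n) // l.IsChain (· ≠ ·)} :=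
  PresentedGroup.toGroup (f := consReducePerm) <| by
    rintro _ ⟨i, rfl⟩
    rw [map_mul, FreeGroup.lift_apply_of]
    exact Equiv.ext fun l => Subtype.ext (consReduce_consReduce i l.2)

theorem reducedWordAction_z2of (i : Fin n) :
    reducedWordAction (z2of i) = consReducePerm i :=
  PresentedGroup.toGroup.of _

theorem reducedWordAction_wordZ (l : List (Fin n)) :
    (reducedWordAction (wordZ l) ⟨[], List.isChain_nil⟩).1 = reduceWord l := by
  induction l with
  | nil => simp [wordZ, reduceWord]
  | cons i l ih =>
    rw [wordZ_cons, map_mul, Equiv.Perm.mul_apply, reducedWordAction_z2of]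
    change consReduce i _ = _
    rw [ih]
    rfl

theorem reduceWord_eq_of_wordZ_eq {l m : List (Fin n)} (h : wordZ l = wordZ m) :
    reduceWord l = reduceWord m := by
  rw [← reducedWordAction_wordZ, ← reducedWordAction_wordZ, h]

theorem wordZ_injOn {l m : List (Fin n)} (hl : l.IsChain (· ≠ ·)) (hm : m.IsChain (· ≠ ·))
    (h : wordZ l = wordZ m) : l = m := by
  rw [← reduceWord_of_isChain hl, ← reduceWord_of_isChain hm, reduceWord_eq_of_wordZ_eq h]

theorem exists_isChain_wordZ (a : Z2Star n) :
    ∃ l : List (Fin n), l.IsChain (· ≠ ·) ∧ wordZ l = a := by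
  suffices ∃ l : List (Fin n), wordZ l = a by
    obtain ⟨l, rfl⟩ := this
    exact ⟨reduceWord l, isChain_reduceWord l, wordZ_reduceWord l⟩
  have ha : a ∈ Subgroup.closure (Set.range (PresentedGroup.of (rels := z2Rels n))) := by
    rw [PresentedGroup.closure_range_of]
    trivial
  induction ha using Subgroup.closure_induction with
  | mem x hx =>
    obtain ⟨i, rfl⟩ := hx
    exact ⟨[i], by simp [wordZ, z2of]⟩
  | one => exact ⟨[], rfl⟩
  | mul x y _ _ hx hy =>
    obtain ⟨l, rfl⟩ := hx
    obtain ⟨m, rfl⟩ := hy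
    exact ⟨l ++ m, wordZ_append l m⟩
  | inv x _ hx =>
    obtain ⟨l, rfl⟩ := hx
    exact ⟨l.reverse, (wordZ_inv l).symm⟩

theorem isChain_reverse_append_cons {l t : List (Fin n)} {i : Fin n}
    (hl : (i :: l).IsChain (· ≠ ·)) (ht : (i :: t).IsChain (· ≠ ·)) :
    (l.reverse ++ i :: t).IsChain (· ≠ ·) := by
  have h : ((i :: l).reverse).IsChain (· ≠ ·) := by
    rw [List.isChain_reverse]
    exact hl.imp fun _ _ => Ne.symm
  rw [List.reverse_cons] at h
  exact List.isChain_split.2 ⟨h, ht⟩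

/-- A word representing the same element as a reduced word `m` is either equal to `m` or longer
by at least two letters. -/
theorem eq_or_length_of_wordZ_eq {l m : List (Fin n)} (hm : m.IsChain (· ≠ ·))
    (h : wordZ l = wordZ m) : l = m ∨ m.length + 2 ≤ l.length := by
  have := reduceWord_eq_or_length l
  rw [reduceWord_eq_of_wordZ_eq h, reduceWord_of_isChain hm] at this
  exact this.imp_left Eq.symm

theorem ShortlexLT.shortlex {l m : List (Fin n)} (h : ShortlexLT l m) :
    List.Shortlex (· < ·) l m :=
  List.shortlex_def.2 h

theorem ShortlexLT.irrefl (l : List (Fin n)) : ¬ ShortlexLT l l := fun h =>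
  asymm h.shortlex h.shortlex

theorem ShortlexLT.length_le {l m : List (Fin n)} (h : ShortlexLT l m) : l.length ≤ m.length :=
  h.elim le_of_lt fun h => h.1.le

theorem ShortlexLT.trans {l m k : List (Fin n)} (h : ShortlexLT l m) (h' : ShortlexLT m k) :
    ShortlexLT l k := by
  rcases h with h | ⟨h, hl⟩ <;> rcases h' with h' | ⟨h', hl'⟩
  · exact Or.inl (h.trans h')
  · exact Or.inl (h.trans_eq h')
  · exact Or.inl (h.trans_lt h')
  · exact Or.inr ⟨h.trans h', lt_trans (α := List (Fin n)) hl hl'⟩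

theorem ShortlexLT.trichotomy (l m : List (Fin n)) :
    ShortlexLT l m ∨ l = m ∨ ShortlexLT m l := by
  have := trichotomous_of (List.Shortlex (α := Fin n) (· < ·)) l m
  rw [List.shortlex_def, List.shortlex_def] at this
  exact this

theorem cons_shortlexLT {i : Fin n} {l t la lc : List (Fin n)}
    (hl : (i :: l).IsChain (· ≠ ·)) (ht : (i :: t).IsChain (· ≠ ·))
    (hls : ShortlexLT l (i :: t)) (ha : ShortlexLT la (i :: t)) (hc : ShortlexLT lc (i :: t))
    (h : (wordZ la)⁻¹ * wordZ lc = (wordZ l)⁻¹ * wordZ (i :: t)) :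
    ShortlexLT (i :: l) (i :: t) := by
  rw [wordZ_inv, wordZ_inv, ← wordZ_append, ← wordZ_append] at h
  have hne : lc ≠ i :: t := by rintro rfl; exact ShortlexLT.irrefl _ hc
  have h₁ := hls.length_le
  have h₂ := ha.length_le
  have h₃ := hc.length_le
  simp only [List.length_cons] at h₁ h₂ h₃
  by_cases hlen : l.length < t.length
  · exact Or.inl (by simpa using hlen)
  rcases eq_or_length_of_wordZ_eq (isChain_reverse_append_cons hl ht) h with h | h
  · have hlen' := congrArg List.length h
    simp only [List.length_append, List.length_reverse, List.length_cons] at hlen'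
    rcases eq_or_ne la.length l.length with he | he
    · exact absurd (List.append_inj_right h (by simpa using he)) hne
    · have hla : la.length = l.length + 1 := by omega
      have h' : la.reverse ++ lc = (i :: l).reverse ++ t := by simpa using h
      have := List.append_inj_left h' (by simpa using hla)
      rwa [← List.reverse_injective this]
  · simp only [List.length_append, List.length_reverse, List.length_cons] at h
    omega

theorem eq_tail_of_inv_mul_eq {i : Fin n} {l m t : List (Fin n)}
    (hl : (i :: l).IsChain (· ≠ ·)) (hm : (i :: m).IsChain (· ≠ ·)) (ht : (i :: t).IsChain (· ≠ ·))
    (hls : ShortlexLT l (i :: t)) (hl' : ¬ ShortlexLT (i :: l) (i :: t))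
    (h : (wordZ l)⁻¹ * wordZ (i :: t) = (wordZ (i :: t))⁻¹ * wordZ m) : l = t := by
  have h₁ := hls.length_le
  have h₂ : ¬ l.length < t.length := fun h => hl' (Or.inl (by simpa using h))
  have h : l.reverse ++ i :: t = t.reverse ++ i :: m := by
    refine wordZ_injOn (isChain_reverse_append_cons hl ht) (isChain_reverse_append_cons ht hm) ?_
    rw [wordZ_append, ← wordZ_inv, h, wordZ_inv, ← wordZ_append]
    simp
  simp only [List.length_cons] at h₁
  rcases eq_or_ne l.length t.length with he | he
  · exact List.reverse_injective (List.append_inj_left h (by simpa using he))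
  · have h' : l.reverse ++ i :: t = (i :: t).reverse ++ m := by simpa using h
    have := List.reverse_injective
      (List.append_inj_left h' (by simp only [List.length_reverse, List.length_cons]; omega))
    exact absurd (this ▸ hls) (ShortlexLT.irrefl _)

end Words

section PartialIsometry

variable {H : Type*} [NormedAddCommGroup H] [InnerProductSpace ℂ H] [CompleteSpace H] {ι : Type*}

theorem clm_ext_of_orthogonal {F : Type*} [NormedAddCommGroup F] [NormedSpace ℂ F] (a : ι → H)
    {S T : H →L[ℂ] F} (h : ∀ i, S (a i) = T (a i))
    (h' : ∀ x, (∀ i, ⟪a i, x⟫ = 0) → S x = T x) : S = T := by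
  let M := (Submodule.span ℂ (Set.range a)).topologicalClosure
  have : CompleteSpace M := (Submodule.isClosed_topologicalClosure _).completeSpace_coe
  have hM : ∀ x ∈ M, S x = T x := by
    intro x hx
    have hle : M ≤ (S - T).ker := by
      refine Submodule.topologicalClosure_minimal _ ?_ (S - T).isClosed_ker
      rw [Submodule.span_le]
      rintro _ ⟨i, rfl⟩
      simp [h i]
    simpa [sub_eq_zero] using hle hx
  ext x
  obtain ⟨y, hy, z, hz, rfl⟩ := M.exists_add_mem_mem_orthogonal x
  rw [map_add, map_add, hM y hy, h' z fun i => ?_]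
  exact hz _ (Submodule.le_topologicalClosure _ (Submodule.subset_span ⟨i, rfl⟩))

/-- Two families with the same Gram matrix are intertwined by a partial isometry. -/
theorem exists_partialIsometry_of_gram (a b : ι → H) (h : ∀ i j, ⟪b i, b j⟫ = ⟪a i, a j⟫) :
    ∃ T : H →L[ℂ] H, (∀ i, T (a i) = b i) ∧ ∀ x, (∀ i, ⟪a i, x⟫ = 0) → T x = 0 := by
  let M := (Submodule.span ℂ (Set.range a)).topologicalClosure
  have : CompleteSpace M := (Submodule.isClosed_topologicalClosure _).completeSpace_coe
  have hmem : ∀ c : ι →₀ ℂ, Finsupp.linearCombination ℂ a c ∈ Submodule.span ℂ (Set.range a) :=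
    fun c => by
      rw [← Finsupp.range_linearCombination]
      exact ⟨c, rfl⟩
  let e : (ι →₀ ℂ) →ₗ[ℂ] M :=
    (Finsupp.linearCombination ℂ a).codRestrict M fun c =>
      Submodule.le_topologicalClosure _ (hmem c)
  have he : DenseRange e := by
    intro x
    rw [Metric.mem_closure_iff]
    intro ε hε
    obtain ⟨y, hy, hxy⟩ := Metric.mem_closure_iff.1
      (show (x : H) ∈ closure (Submodule.span ℂ (Set.range a) : Set H) from x.2) ε hε
    rw [SetLike.mem_coe, ← Finsupp.range_linearCombination] at hy
    obtain ⟨c, rfl⟩ := hy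
    exact ⟨e c, ⟨c, rfl⟩, hxy⟩
  let f := Finsupp.linearCombination ℂ b
  have hinner : ∀ c : ι →₀ ℂ, ⟪f c, f c⟫ =
      ⟪Finsupp.linearCombination ℂ a c, Finsupp.linearCombination ℂ a c⟫ := fun c => by
    simp only [f, Finsupp.linearCombination_apply, Finsupp.sum_inner, Finsupp.inner_sum,
      inner_smul_left, inner_smul_right, h]
  have hnorm : ∀ c, ‖f c‖ ≤ 1 * ‖e c‖ := fun c => by
    rw [one_mul, ← Submodule.norm_coe, norm_eq_sqrt_re_inner (𝕜 := ℂ),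
      norm_eq_sqrt_re_inner (𝕜 := ℂ), hinner]
    rfl
  refine ⟨f.extendOfNorm e ∘L M.orthogonalProjectionOnto, fun i => ?_, fun x hx => ?_⟩
  · have hi : e (Finsupp.single i 1) = a i := by
      change Finsupp.linearCombination ℂ a (Finsupp.single i 1) = a i
      simp
    rw [ContinuousLinearMap.comp_apply, ← hi, Submodule.orthogonalProjectionOnto_mem_subspace_eq_self,
      LinearMap.extendOfNorm_eq he ⟨1, hnorm⟩]
    simp [f]
  · have hx' : x ∈ Mᗮ := by
      rw [Submodule.orthogonal_closure, Submodule.mem_orthogonal]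
      intro y hy
      induction hy using Submodule.span_induction with
      | mem y hy => obtain ⟨i, rfl⟩ := hy; exact hx i
      | zero => simp
      | add y z _ _ hy hz => rw [inner_add_left, hy, hz, add_zero]
      | smul c y _ hy => rw [inner_smul_left, hy, mul_zero]
    rw [ContinuousLinearMap.comp_apply,
      Submodule.orthogonalProjectionOnto_apply_of_mem_orthogonal hx', map_zero]

open ContinuousLinearMap in
theorem adjoint_partialIsometry_of_gram {a b : ι → H} (h : ∀ i j, ⟪b i, b j⟫ = ⟪a i, a j⟫)
    {T : H →L[ℂ] H} (hT : ∀ i, T (a i) = b i) (hT' : ∀ x, (∀ i, ⟪a i, x⟫ = 0) → T x = 0) :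
    (∀ i, adjoint T (b i) = a i) ∧ ∀ x, (∀ i, ⟪b i, x⟫ = 0) → adjoint T x = 0 := by
  constructor
  · intro i
    have : innerSL ℂ (adjoint T (b i)) = innerSL ℂ (a i) := by
      refine clm_ext_of_orthogonal a (fun j => ?_) fun x hx => ?_
      · simp [adjoint_inner_left, hT, h]
      · simp [adjoint_inner_left, hT' x hx, hx]
    refine ext_inner_right ℂ fun y => ?_
    simpa using DFunLike.congr_fun this y
  · intro x hx
    have : innerSL ℂ (adjoint T x) = 0 := by
      refine clm_ext_of_orthogonal a (fun j => ?_) fun y hy => ?_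
      · simp [adjoint_inner_left, hT, inner_eq_zero_symm.1 (hx j)]
      · simp [adjoint_inner_left, hT' y hy]
    refine ext_inner_right ℂ fun y => ?_
    simpa using DFunLike.congr_fun this y

end PartialIsometry

section Dilation

variable {n : ℕ} {G : Type*} [Group G] {E : Type*} [NormedAddCommGroup E] [InnerProductSpace ℂ E]

theorem formSum_eq_sum (χ : Z2Star n → G → (E →L[ℂ] E)) (f : Z2Star n → G →₀ E)
    (S : Finset (Z2Star n)) (T : Finset G) (hT : ∀ u ∈ S, (f u).support ⊆ T) :
    (∑ᶠ u ∈ (S : Set (Z2Star n)), ∑ᶠ v ∈ (S : Set (Z2Star n)), ∑ᶠ g₁ : G, ∑ᶠ h₁ : G,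
      ⟪f u g₁, χ (u⁻¹ * v) (g₁⁻¹ * h₁) (f v h₁)⟫) =
    ∑ u ∈ S, ∑ v ∈ S, ∑ g₁ ∈ T, ∑ h₁ ∈ T, ⟪f u g₁, χ (u⁻¹ * v) (g₁⁻¹ * h₁) (f v h₁)⟫ := by
  have hzero : ∀ u ∈ S, ∀ g ∉ T, f u g = 0 := fun u hu g hg => by
    by_contra h
    exact hg (hT u hu (Finsupp.mem_support_iff.2 h))
  rw [finsum_mem_coe_finset]
  refine Finset.sum_congr rfl fun u hu => ?_
  rw [finsum_mem_coe_finset]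
  refine Finset.sum_congr rfl fun v hv => ?_
  rw [finsum_eq_sum_of_support_subset (s := T)]
  · refine Finset.sum_congr rfl fun g₁ _ => finsum_eq_sum_of_support_subset _ fun h₁ hh => ?_
    by_contra hn
    simp [hzero v hv h₁ hn] at hh
  · intro g₁ hg
    by_contra hn
    simp [hzero u hu g₁ hn] at hg

open Classical in
theorem exists_finset_support_subset {ι α M : Type*} [Zero M] (f : ι → α →₀ M) (S : Finset ι) :
    ∃ T : Finset α, ∀ u ∈ S, (f u).support ⊆ T :=
  ⟨S.biUnion fun u => (f u).support, fun _ hu => Finset.subset_biUnion_of_mem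
    (fun u => (f u).support) hu⟩

theorem formPSD_of_gram {H : Type*} [NormedAddCommGroup H] [InnerProductSpace ℂ H]
    {W : Set (Z2Star n)} (hW : W.Finite) {χ : Z2Star n → G → (E →L[ℂ] E)}
    (V : Z2Star n → G → E → H)
    (hV : ∀ u ∈ W, ∀ v ∈ W, ∀ g h e e',
      ⟪V u g e, V v h e'⟫ = ⟪e, χ (u⁻¹ * v) (g⁻¹ * h) e'⟫) :
    FormPSD W χ := by
  intro f
  obtain ⟨T, hT⟩ := exists_finset_support_subset f hW.toFinset
  have key := formSum_eq_sum χ f hW.toFinset T hT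
  rw [hW.coe_toFinset] at key
  rw [key]
  have : ∑ u ∈ hW.toFinset, ∑ v ∈ hW.toFinset, ∑ g₁ ∈ T, ∑ h₁ ∈ T,
      ⟪f u g₁, χ (u⁻¹ * v) (g₁⁻¹ * h₁) (f v h₁)⟫ =
      ⟪∑ u ∈ hW.toFinset, ∑ g ∈ T, V u g (f u g), ∑ u ∈ hW.toFinset, ∑ g ∈ T, V u g (f u g)⟫ := by
    rw [sum_inner]
    refine Finset.sum_congr rfl fun u hu => ?_
    rw [inner_sum]
    refine Finset.sum_congr rfl fun v hv => ?_
    rw [sum_inner]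
    refine Finset.sum_congr rfl fun g _ => ?_
    rw [inner_sum]
    refine Finset.sum_congr rfl fun h _ => ?_
    rw [hV u (hW.mem_toFinset.1 hu) v (hW.mem_toFinset.1 hv)]
  rw [this]
  exact ⟨inner_self_nonneg (𝕜 := ℂ), inner_self_im (𝕜 := ℂ) _⟩

open Classical in
/-- The operator-valued kernel on `ℤ₂^{*n} × G` of a partially defined form, zero off `W`. -/
noncomputable def formKernel (W : Set (Z2Star n)) (χ : Z2Star n → G → (E →L[ℂ] E)) :
    Matrix (Z2Star n × G) (Z2Star n × G) (E →L[ℂ] E) :=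
  Matrix.of fun x y => if x.1 ∈ W ∧ y.1 ∈ W then χ (x.1⁻¹ * y.1) (x.2⁻¹ * y.2) else 0

theorem formKernel_of_mem {W : Set (Z2Star n)} {χ : Z2Star n → G → (E →L[ℂ] E)} {u v : Z2Star n}
    (hu : u ∈ W) (hv : v ∈ W) (g h : G) :
    formKernel W χ (u, g) (v, h) = χ (u⁻¹ * v) (g⁻¹ * h) := by
  simp [formKernel, hu, hv]

theorem formKernel_of_notMem_left {W : Set (Z2Star n)} {χ : Z2Star n → G → (E →L[ℂ] E)}
    {u : Z2Star n} (hu : u ∉ W) (v : Z2Star n) (g h : G) :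
    formKernel W χ (u, g) (v, h) = 0 := by
  simp [formKernel, hu]

theorem formKernel_of_notMem_right {W : Set (Z2Star n)} {χ : Z2Star n → G → (E →L[ℂ] E)}
    (u : Z2Star n) {v : Z2Star n} (hv : v ∉ W) (g h : G) :
    formKernel W χ (u, g) (v, h) = 0 := by
  simp [formKernel, hv]

open Classical in
theorem FormPSD.formKernel_sum {W : Set (Z2Star n)} (hW : W.Finite)
    {χ : Z2Star n → G → (E →L[ℂ] E)} (hχ : FormPSD W χ) (p : Z2Star n × G →₀ E) :
    0 ≤ (p.sum fun x e => p.sum fun y e' => ⟪e, formKernel W χ x y e'⟫).re ∧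
      (p.sum fun x e => p.sum fun y e' => ⟪e, formKernel W χ x y e'⟫).im = 0 := by
  let S := hW.toFinset
  let S' := S ∪ p.support.image Prod.fst
  let T := p.support.image Prod.snd
  have hS : ∀ {u}, u ∉ S → u ∉ W := fun h => by simpa [S] using h
  have hsupp : p.support ⊆ S' ×ˢ T := fun x hx => Finset.mem_product.2
    ⟨Finset.mem_union_right _ (Finset.mem_image_of_mem _ hx), Finset.mem_image_of_mem _ hx⟩
  have hsum : (p.sum fun x e => p.sum fun y e' => ⟪e, formKernel W χ x y e'⟫) =
      ∑ u ∈ S, ∑ v ∈ S, ∑ g ∈ T, ∑ h ∈ T, ⟪p.curry u g, χ (u⁻¹ * v) (g⁻¹ * h) (p.curry v h)⟫ := by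
    have h₁ : ∀ x e, (p.sum fun y e' => ⟪e, formKernel W χ x y e'⟫) =
        ∑ v ∈ S', ∑ h ∈ T, ⟪e, formKernel W χ x (v, h) (p (v, h))⟫ := fun x e => by
      rw [Finsupp.sum_of_support_subset p hsupp _ (by simp), Finset.sum_product]
    simp only [h₁]
    rw [Finsupp.sum_of_support_subset p hsupp _ (by simp), Finset.sum_product]
    rw [← Finset.sum_subset (s₁ := S) Finset.subset_union_left
      fun u _ hu => by simp [formKernel_of_notMem_left (hS hu)]]
    refine Finset.sum_congr rfl fun u hu => ?_
    rw [Finset.sum_comm, ← Finset.sum_subset (s₁ := S) Finset.subset_union_left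
      fun v _ hv => by simp [formKernel_of_notMem_right _ (hS hv)]]
    refine Finset.sum_congr rfl fun v hv => Finset.sum_congr rfl fun g _ =>
      Finset.sum_congr rfl fun h _ => ?_
    rw [formKernel_of_mem (by simpa [S] using hu) (by simpa [S] using hv)]
    rfl
  have hT : ∀ u ∈ S, (p.curry u).support ⊆ T := fun u _ g hg =>
    Finset.mem_image.2 ⟨(u, g), by simpa using hg, rfl⟩
  have h := hχ fun u => p.curry u
  have key := formSum_eq_sum χ (fun u => p.curry u) S T hT
  rw [hW.coe_toFinset] at key
  rw [key] at h
  rwa [hsum]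

theorem FormPSD.inner_formKernel {W : Set (Z2Star n)} (hW : W.Finite)
    {χ : Z2Star n → G → (E →L[ℂ] E)} (hχ : FormPSD W χ) (x y : Z2Star n × G) (e e' : E) :
    ⟪e, formKernel W χ x y e'⟫ = ⟪formKernel W χ y x e, e'⟫ := by
  have him : ∀ e', (⟪e, formKernel W χ x y e'⟫ + ⟪e', formKernel W χ y x e⟫).im = 0 := by
    intro e'
    have hs := fun p => (hχ.formKernel_sum hW p).2
    have h₁ := hs (Finsupp.single x e)
    have h₂ := hs (Finsupp.single y e')
    have h₃ := hs (Finsupp.single x e + Finsupp.single y e')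
    have hadd : ∀ z d, ((Finsupp.single x e + Finsupp.single y e').sum
        fun y e' => ⟪d, formKernel W χ z y e'⟫) =
        ⟪d, formKernel W χ z x e⟫ + ⟪d, formKernel W χ z y e'⟫ := fun z d => by
      rw [Finsupp.sum_add_index' (fun _ => by rw [map_zero, inner_zero_right])
        (fun _ _ _ => by rw [map_add, inner_add_right])]
      simp
    simp only [hadd] at h₃
    rw [Finsupp.sum_add_index' (fun _ => by simp)
      (fun _ _ _ => by simp only [inner_add_left]; ring)] at h₃
    simp at h₁ h₂ h₃ ⊢
    linarith
  have h₁ := him e'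
  have h₂ := him (Complex.I • e')
  rw [← inner_conj_symm (formKernel W χ y x e) e']
  simp at h₁ h₂
  apply Complex.ext
  · rw [Complex.conj_re]
    linarith
  · rw [Complex.conj_im]
    linarith

theorem FormPSD.posSemidef_formKernel [CompleteSpace E] {W : Set (Z2Star n)} (hW : W.Finite)
    {χ : Z2Star n → G → (E →L[ℂ] E)} (hχ : FormPSD W χ) : (formKernel W χ).PosSemidef := by
  have h := (RKHS.posSemidef_tfae (K := formKernel W χ)).out 0 2
  refine h.2 ⟨?_, fun p => ?_⟩
  · ext x y e
    refine ext_inner_left ℂ fun e' => ?_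
    rw [Matrix.conjTranspose_apply, ContinuousLinearMap.star_eq_adjoint,
      ContinuousLinearMap.adjoint_inner_right, hχ.inner_formKernel hW]
  · simp only [← hχ.inner_formKernel hW]
    exact (hχ.formKernel_sum hW p).1

/-- A psd form admits a Kolmogorov decomposition. -/
theorem FormPSD.exists_gram {n : ℕ} {G E : Type} [Group G] [NormedAddCommGroup E]
    [InnerProductSpace ℂ E] [CompleteSpace E] {W : Set (Z2Star n)} (hW : W.Finite)
    {χ : Z2Star n → G → (E →L[ℂ] E)} (hχ : FormPSD W χ) :
    ∃ (H : Type) (_ : NormedAddCommGroup H) (_ : InnerProductSpace ℂ H) (_ : CompleteSpace H)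
      (V : Z2Star n → G → E →L[ℂ] H), ∀ u ∈ W, ∀ v ∈ W, ∀ g h e e',
        ⟪V u g e, V v h e'⟫ = ⟪e, χ (u⁻¹ * v) (g⁻¹ * h) e'⟫ := by
  have : Fact (formKernel W χ).PosSemidef := ⟨hχ.posSemidef_formKernel hW⟩
  refine ⟨RKHS.OfKernel (formKernel W χ), inferInstance, inferInstance, inferInstance,
    fun u g => RKHS.kerFun _ (u, g), fun u hu v hv g h e e' => ?_⟩
  rw [← RKHS.kernel_inner, RKHS.OfKernel.kernel_ofKernel, ← hχ.inner_formKernel hW,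
    formKernel_of_mem hu hv]

/-- The flip on a Kolmogorov decomposition: if `h` is an involution, then `V u ↦ V (h u)`, for
those `u` in `W` with `h u` in `W`, defines a self-adjoint partial isometry that commutes with
translations by `G`. -/
theorem exists_flip {H : Type*} [NormedAddCommGroup H] [InnerProductSpace ℂ H] [CompleteSpace H]
    {W : Set (Z2Star n)} {χ : Z2Star n → G → (E →L[ℂ] E)} {V : Z2Star n → G → E →L[ℂ] H}
    (hV : ∀ u ∈ W, ∀ v ∈ W, ∀ g h e e',
      ⟪V u g e, V v h e'⟫ = ⟪e, χ (u⁻¹ * v) (g⁻¹ * h) e'⟫)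
    {t : Z2Star n} (ht : t * t = 1) :
    ∃ T : H →L[ℂ] H,
      (∀ u ∈ W, t * u ∈ W → ∀ g e, T (V u g e) = V (t * u) g e) ∧
      (∀ x y, ⟪T x, y⟫ = ⟪x, T y⟫) ∧ (∀ x, T (T (T x)) = T x) ∧
      ∀ u ∈ W, ∀ v ∈ W, ∀ k g h e e',
        ⟪V u (k * g) e, T (V v (k * h) e')⟫ = ⟪V u g e, T (V v h e')⟫ := by
  let a : {u // u ∈ W ∧ t * u ∈ W} × G × E → H := fun i => V i.1 i.2.1 i.2.2
  let b : {u // u ∈ W ∧ t * u ∈ W} × G × E → H := fun i => V (t * i.1) i.2.1 i.2.2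
  let σ : {u // u ∈ W ∧ t * u ∈ W} × G × E → {u // u ∈ W ∧ t * u ∈ W} × G × E := fun i =>
    (⟨t * i.1, i.1.2.2, by rw [← mul_assoc, ht, one_mul]; exact i.1.2.1⟩, i.2)
  have haσ : ∀ i, a (σ i) = b i := fun i => rfl
  have hbσ : ∀ i, b (σ i) = a i := fun i => by
    simp only [a, b, σ, ← mul_assoc, ht, one_mul]
  have hab : ∀ i j, ⟪b i, b j⟫ = ⟪a i, a j⟫ := fun i j => by
    simp only [a, b]
    rw [hV _ i.1.2.2 _ j.1.2.2, hV _ i.1.2.1 _ j.1.2.1, mul_inv_rev, mul_assoc,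
      inv_mul_cancel_left]
  obtain ⟨T, hT, hT'⟩ := exists_partialIsometry_of_gram a b hab
  obtain ⟨hTs, hTs'⟩ := adjoint_partialIsometry_of_gram hab hT hT'
  have hsa : ContinuousLinearMap.adjoint T = T := by
    refine clm_ext_of_orthogonal a (fun i => ?_) fun x hx => ?_
    · rw [hT, ← hbσ, hTs, haσ]
    · rw [hT' x hx, hTs' x fun i => by rw [← haσ]; exact hx _]
  have hTTT : T ∘L T ∘L T = T := by
    refine clm_ext_of_orthogonal a (fun i => ?_) fun x hx => ?_
    · simp only [ContinuousLinearMap.comp_apply]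
      rw [hT, ← haσ, hT, hbσ, hT, haσ]
    · simp only [ContinuousLinearMap.comp_apply]
      rw [hT' x hx, map_zero, map_zero]
  refine ⟨T, fun u hu htu g e => hT (⟨u, hu, htu⟩, g, e), fun x y => ?_,
    fun x => DFunLike.congr_fun hTTT x, fun u hu v hv k g h e e' => ?_⟩
  · rw [← ContinuousLinearMap.adjoint_inner_right, hsa]
  let c : W × G × E → H := fun i => V i.1 i.2.1 i.2.2
  let d : W × G × E → H := fun i => V i.1 (k * i.2.1) i.2.2
  have hcd : ∀ i j, ⟪d i, d j⟫ = ⟪c i, c j⟫ := fun i j => by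
    simp only [c, d]
    rw [hV _ i.1.2 _ j.1.2, hV _ i.1.2 _ j.1.2, mul_inv_rev, mul_assoc, inv_mul_cancel_left]
  obtain ⟨L, hL, hL'⟩ := exists_partialIsometry_of_gram c d hcd
  have hLs := (adjoint_partialIsometry_of_gram hcd hL hL').1
  have hcomm : ContinuousLinearMap.adjoint L ∘L T ∘L L = T := by
    have hLV : ∀ u ∈ W, ∀ g e, L (V u g e) = V u (k * g) e := fun u hu g e =>
      hL (⟨u, hu⟩, g, e)
    have hLsV : ∀ u ∈ W, ∀ g e, ContinuousLinearMap.adjoint L (V u (k * g) e) = V u g e :=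
      fun u hu g e => hLs (⟨u, hu⟩, g, e)
    refine clm_ext_of_orthogonal a (fun i => ?_) fun x hx => ?_
    · obtain ⟨⟨u, hu, htu⟩, g, e⟩ := i
      simp only [ContinuousLinearMap.comp_apply]
      rw [hT]
      change ContinuousLinearMap.adjoint L (T (L (V u g e))) = V (t * u) g e
      rw [hLV u hu, ← hLsV _ htu]
      exact congrArg _ (hT (⟨u, hu, htu⟩, k * g, e))
    · simp only [ContinuousLinearMap.comp_apply]
      rw [hT' x hx, hT', map_zero]
      rintro ⟨⟨u, hu, htu⟩, g, e⟩
      change ⟪V u g e, L x⟫ = 0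
      rw [← ContinuousLinearMap.adjoint_inner_left, ← mul_inv_cancel_left k g, hLsV u hu]
      exact hx (⟨u, hu, htu⟩, k⁻¹ * g, e)
  have h₁ : L (V u g e) = V u (k * g) e := hL (⟨u, hu⟩, g, e)
  have h₂ : L (V v h e') = V v (k * h) e' := hL (⟨v, hv⟩, h, e')
  rw [← h₁, ← h₂, ← ContinuousLinearMap.adjoint_inner_right]
  exact congrArg _ (DFunLike.congr_fun hcomm (V v h e'))

open Classical in
/-- A psd form on `W` extends to `W ∪ {s}` when an involution `t` moves `s`, together with all
indices whose relation to `s` is already prescribed, into `W`, and `t s` is the only index which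
can occur in a symmetric constraint on the new values. -/
theorem FormPSD.exists_extension_insert {n : ℕ} {G E : Type} [Group G] [NormedAddCommGroup E]
    [InnerProductSpace ℂ E] [CompleteSpace E] {W : Set (Z2Star n)} (hW : W.Finite)
    {χ : Z2Star n → G → (E →L[ℂ] E)} (hχ : FormPSD W χ) {s t : Z2Star n} (ht : t * t = 1)
    (hts : t * s ∈ W)
    (hmem : ∀ u ∈ W, ∀ a ∈ W, ∀ c ∈ W, a⁻¹ * c = u⁻¹ * s → t * u ∈ W)
    (hsymm : ∀ u ∈ W, ∀ v ∈ W, t * u ∉ W → t * v ∉ W → u⁻¹ * s = s⁻¹ * v → u = t * s) :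
    ∃ χ' : Z2Star n → G → (E →L[ℂ] E),
      (∀ a ∈ W, ∀ c ∈ W, χ' (a⁻¹ * c) = χ (a⁻¹ * c)) ∧ FormPSD (insert s W) χ' := by
  by_cases hs : s ∈ W
  · exact ⟨χ, fun _ _ _ _ => rfl, by rwa [Set.insert_eq_of_mem hs]⟩
  obtain ⟨H, _, _, _, V, hV⟩ := hχ.exists_gram hW
  obtain ⟨T, hT, hsa, hTTT, hinv⟩ := exists_flip hV ht
  let her (α : Z2Star n) : Prop := ∃ a ∈ W, ∃ c ∈ W, a⁻¹ * c = α
  let χ' : Z2Star n → G → (E →L[ℂ] E) := fun α g =>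
    if her α then χ α g
    else if s * α⁻¹ ∈ W then
      ContinuousLinearMap.adjoint (V (s * α⁻¹) 1) ∘L T ∘L V (t * s) g
    else ContinuousLinearMap.adjoint (V (t * s) 1) ∘L T ∘L V (s * α) g
  have hher : ∀ a ∈ W, ∀ c ∈ W, χ' (a⁻¹ * c) = χ (a⁻¹ * c) := fun a ha c hc =>
    funext fun g => if_pos ⟨a, ha, c, hc, rfl⟩
  have htu : ∀ u, (t * u)⁻¹ * (t * s) = u⁻¹ * s := fun u => by
    rw [mul_inv_rev, mul_assoc, inv_mul_cancel_left]
  have htu' : ∀ u, (t * s)⁻¹ * (t * u) = s⁻¹ * u := fun u => by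
    rw [mul_inv_rev, mul_assoc, inv_mul_cancel_left]
  have hnorm : ∀ u ∈ W, ∀ v ∈ W, ∀ g h e e',
      ⟪V u g e, T (V v h e')⟫ = ⟪V u 1 e, T (V v (g⁻¹ * h) e')⟫ := fun u hu v hv g h e e' => by
    have := hinv u hu v hv g 1 (g⁻¹ * h) e e'
    rwa [mul_one, mul_inv_cancel_left] at this
  have hright : ∀ u ∈ W, ∀ g h e e',
      ⟪V u g e, T (V (t * s) h e')⟫ = ⟪e, χ' (u⁻¹ * s) (g⁻¹ * h) e'⟫ := by
    intro u hu g h e e'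
    by_cases hα : her (u⁻¹ * s)
    · obtain ⟨a, ha, c, hc, hac⟩ := hα
      have hu' := hmem u hu a ha c hc hac
      rw [← hsa, hT u hu hu', hV _ hu' _ hts, ← hher _ hu' _ hts, htu]
    · have h₁ : s * (u⁻¹ * s)⁻¹ = u := by group
      simp only [χ', if_neg hα, h₁, if_pos hu, ContinuousLinearMap.comp_apply,
        ContinuousLinearMap.adjoint_inner_right]
      exact hnorm u hu _ hts g h e e'
  have hleft : ∀ u ∈ W, ∀ g h e e',
      ⟪V (t * s) g e, T (V u h e')⟫ = ⟪e, χ' (s⁻¹ * u) (g⁻¹ * h) e'⟫ := by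
    intro u hu g h e e'
    by_cases hu' : t * u ∈ W
    · rw [hT u hu hu', hV _ hts _ hu', ← hher _ hts _ hu', htu']
    have hα : ¬ her (s⁻¹ * u) := by
      rintro ⟨a, ha, c, hc, hac⟩
      exact hu' (hmem u hu c hc a ha (by rw [← inv_inj]; simpa using hac))
    by_cases hv : s * (s⁻¹ * u)⁻¹ ∈ W
    · have hvu : (s * (s⁻¹ * u)⁻¹)⁻¹ * s = s⁻¹ * u := by group
      have hv' : t * (s * (s⁻¹ * u)⁻¹) ∉ W := fun hv' =>
        hα ⟨_, hv', _, hts, by rw [htu, hvu]⟩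
      have h₁ : s * (s⁻¹ * u)⁻¹ = t * s := hsymm _ hv _ hu hv' hu' hvu
      have h₂ : u = t * s := hsymm u hu _ hv hu' hv' (by simp)
      rw [← hvu, ← hright _ hv, h₁, h₂]
    · simp only [χ', if_neg hα, if_neg hv, mul_inv_cancel_left, ContinuousLinearMap.comp_apply,
        ContinuousLinearMap.adjoint_inner_right]
      exact hnorm _ hts u hu g h e e'
  refine ⟨χ', hher, formPSD_of_gram (H := WithLp 2 (H × H)) (hW.insert s) (fun u g e =>
    if u = s then WithLp.toLp 2 (T (V (t * s) g e), V (t * s) g e - T (T (V (t * s) g e)))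
    else WithLp.toLp 2 (V u g e, 0)) ?_⟩
  have hne : ∀ {u}, u ∈ W → u ≠ s := fun hu h => hs (h ▸ hu)
  rintro u (rfl | hu) v (rfl | hv) g h e e'
  · have h₁ : ∀ x y, ⟪T x, T y⟫ + ⟪x - T (T x), y - T (T y)⟫ = ⟪x, y⟫ := fun x y => by
      simp only [inner_sub_left, inner_sub_right, hsa, hTTT]
      ring
    rw [if_pos rfl, if_pos rfl, WithLp.prod_inner_apply, h₁, hV _ hts _ hts, ← hher _ hts _ hts,
      htu]
  · rw [if_pos rfl, if_neg (hne hv), WithLp.prod_inner_apply, inner_zero_right, add_zero, hsa,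
      hleft v hv]
  · rw [if_pos rfl, if_neg (hne hu), WithLp.prod_inner_apply, inner_zero_left, add_zero,
      hright u hu]
  · rw [if_neg (hne hu), if_neg (hne hv), WithLp.prod_inner_apply, inner_zero_left, add_zero,
      hV u hu v hv, hher u hu v hv]

end Dilation

section Segments

variable {n : ℕ}

theorem finite_WleZ (w : Z2Star n) : (WleZ w).Finite := by
  obtain ⟨lw, hlw, rfl⟩ := exists_isChain_wordZ w
  refine ((List.finite_length_le (Fin n) lw.length).image wordZ).subset ?_
  rintro _ ⟨l, m, -, hm, rfl, hmw, h⟩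
  rw [wordZ_injOn hm hlw hmw] at h
  exact ⟨l, h.elim ShortlexLT.length_le fun h => (congrArg List.length h).le, rfl⟩

theorem WleZ_of_isChain {l : List (Fin n)} (hl : l.IsChain (· ≠ ·)) :
    WleZ (wordZ l) =
      insert (wordZ l) {v | ∃ m : List (Fin n), m.IsChain (· ≠ ·) ∧ wordZ m = v ∧ ShortlexLT m l} := by
  ext v
  constructor
  · rintro ⟨m, l', hm, hl', rfl, hll', h | rfl⟩
    · rw [wordZ_injOn hl' hl hll'] at h
      exact Or.inr ⟨m, hm, rfl, h⟩
    · exact Or.inl hll'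
  · rintro (rfl | ⟨m, hm, rfl, h⟩)
    · exact ⟨l, l, hl, hl, rfl, rfl, Or.inr rfl⟩
    · exact ⟨m, l, hm, hl, rfl, rfl, Or.inl h⟩

theorem mem_WleZ_iff_of_succ {k l : List (Fin n)} (hk : k.IsChain (· ≠ ·))
    (hl : l.IsChain (· ≠ ·)) (hkl : ShortlexLT k l)
    (hsucc : ∀ v : Z2Star n, Z2ShortlexLT (wordZ k) v → Z2ShortlexLE (wordZ l) v) {v : Z2Star n} :
    v ∈ WleZ (wordZ k) ↔
      ∃ m : List (Fin n), m.IsChain (· ≠ ·) ∧ wordZ m = v ∧ ShortlexLT m l := by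
  rw [WleZ_of_isChain hk]
  constructor
  · rintro (rfl | ⟨m, hm, rfl, h⟩)
    · exact ⟨k, hk, rfl, hkl⟩
    · exact ⟨m, hm, rfl, h.trans hkl⟩
  · rintro ⟨m, hm, rfl, h⟩
    rcases ShortlexLT.trichotomy m k with h' | rfl | h'
    · exact Or.inr ⟨m, hm, rfl, h'⟩
    · exact Or.inl rfl
    · obtain ⟨l', m', hl', hm', hll', hmm', h''⟩ := hsucc _ ⟨k, m, hk, hm, rfl, rfl, h'⟩
      rw [wordZ_injOn hl' hl hll', wordZ_injOn hm' hm hmm'] at h''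
      rcases h'' with h'' | rfl
      · exact absurd (h.trans h'') (ShortlexLT.irrefl _)
      · exact absurd h (ShortlexLT.irrefl _)

theorem cons_shortlexLT_or_isChain {i : Fin n} {l t : List (Fin n)} (hl : l.IsChain (· ≠ ·))
    (h : ShortlexLT l (i :: t)) :
    (∃ m : List (Fin n), m.IsChain (· ≠ ·) ∧ wordZ m = z2of i * wordZ l ∧
      ShortlexLT m (i :: t)) ∨ (i :: l).IsChain (· ≠ ·) := by
  cases l with
  | nil => exact Or.inr (List.isChain_singleton i)
  | cons j l =>
    by_cases hij : i = j
    · subst hij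
      refine Or.inl ⟨l, hl.tail, ?_, Or.inl ?_⟩
      · rw [wordZ_cons, ← mul_assoc, z2of_mul_self, one_mul]
      · exact Nat.lt_of_succ_le h.length_le
    · exact Or.inr (List.isChain_cons_cons.2 ⟨hij, hl⟩)

end Segments

/-- Matrix completion for `ℤ₂^{*g}`: a psd `w`-partially defined form extends to
a psd `s`-partially defined form, `s` the shortlex successor of `w`. -/
theorem stmt13
    (G : Type) [Group G]
    (E : Type) [NormedAddCommGroup E] [InnerProductSpace ℂ E] [CompleteSpace E]
    (g : ℕ) (hg : 2 ≤ g)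
    (w s : Z2Star g)
    (hlt : Z2ShortlexLT w s)
    (hsucc : ∀ v : Z2Star g, Z2ShortlexLT w v → Z2ShortlexLE s v)
    (χ : Z2Star g → G → (E →L[ℂ] E))
    (hχ : FormPSD (WleZ w) χ) :
    ∃ χ' : Z2Star g → G → (E →L[ℂ] E),
      (∀ α ∈ HerWleZ w, χ' α = χ α) ∧ FormPSD (WleZ s) χ' := by
  obtain ⟨k, l, hk, hl, rfl, rfl, hkl⟩ := hlt
  have hmemW := fun v => mem_WleZ_iff_of_succ hk hl hkl hsucc (v := v)
  have hWs : WleZ (wordZ l) = insert (wordZ l) (WleZ (wordZ k)) := by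
    rw [WleZ_of_isChain hl]
    exact congrArg _ (Set.ext fun v => (hmemW v).symm)
  cases l with
  | nil => exact absurd hkl.length_le (by rcases hkl with h | ⟨-, h⟩ <;> simp at h)
  | cons i t =>
    have hti : z2of i * wordZ (i :: t) = wordZ t := by
      rw [wordZ_cons, ← mul_assoc, z2of_mul_self, one_mul]
    obtain ⟨χ', h, h'⟩ := hχ.exists_extension_insert (finite_WleZ _) (s := wordZ (i :: t))
      (t := z2of i) (z2of_mul_self i)
      (by
        rw [hti, hmemW]
        exact ⟨t, hl.tail, rfl, Or.inl (by simp)⟩)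
      (by
        intro u hu a ha c hc hac
        rw [hmemW] at hu ha hc ⊢
        obtain ⟨lu, hlu, rfl, hu⟩ := hu
        obtain ⟨la, -, rfl, ha⟩ := ha
        obtain ⟨lc, -, rfl, hc⟩ := hc
        rcases cons_shortlexLT_or_isChain hlu hu with h | h
        · exact h
        · exact ⟨i :: lu, h, wordZ_cons i lu, cons_shortlexLT h hl hu ha hc hac⟩)
      (by
        intro u hu v hv hu' hv' huv
        rw [hmemW] at hu hv hu' hv'
        obtain ⟨lu, hlu, rfl, hu⟩ := hu
        obtain ⟨lv, hlv, rfl, hv⟩ := hv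
        have hcu := (cons_shortlexLT_or_isChain hlu hu).resolve_left hu'
        have hcv := (cons_shortlexLT_or_isChain hlv hv).resolve_left hv'
        rw [hti, eq_tail_of_inv_mul_eq hcu hcv hl hu
          (fun h => hu' ⟨i :: lu, hcu, wordZ_cons i lu, h⟩) huv])
    refine ⟨χ', ?_, hWs ▸ h'⟩
    rintro _ ⟨a, ha, c, hc, rfl⟩
    exact h a ha c hc
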